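/- arXiv:1512.05321 — 2 statements merged into one kernel-verified Lean document; each statement's English description precedes it below -/
import Mathlib

section
/- Fix T* > 0 and set 𝒯 := {(t,T) ∈ ℝ² : 0 ≤ t ≤ T ≤ T*}; for (x,y) ∈ 𝒯 set 𝒯_{x,y} := {(t,T) ∈ 𝒯 : t ≤ x and T ≤ y}. Let α > 0 and γ ≥ 1 satisfy αγ > 2 and γT* > 1, let 0 < x < y < min(α/2, T*) with γ(y − x) > 1, and let 0 < δ < y. Define R_{α,γ}(z) := α·(log(γ·(z + e²)))³ for z ≥ 0. Let g₁, g₂ : 𝒯_{x,y−δ} → [0, ∞) be measurable with g₂ bounded and g₁(t,T) ≥ g₂(t,T) ≥ 0 for all (t,T) ∈ 𝒯_{x,y−δ}. Suppose f₁ : 𝒯_{x,y−δ} → [0, ∞) is a bounded measurable function satisfying f₁(t,T) ≥ exp(∫₀ᵗ R_{α,γ}(∫ₛᵀ f₁(s,u) du) ds)·g₁(t,T) for all (t,T) ∈ 𝒯_{x,y−δ}, and f₂ : 𝒯_{x,y−δ} → [0, ∞) is a bounded measurable function satisfying f₂(t,T) = exp(∫₀ᵗ R_{α,γ}(∫ₛᵀ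 f₂(s,u) du) ds)·g₂(t,T) for all (t,T) ∈ 𝒯_{x,y−δ}. Then f₁(t,T) ≥ f₂(t,T) for all (t,T) ∈ 𝒯_{x,y−δ}. -/
open MeasureTheory Set intervalIntegral

theorem mul_log_pow_three_le_add {α γ B z₁ z₂ d : ℝ} (hα : 0 < α) (hγ : 1 ≤ γ) (hz₁ : 0 ≤ z₁)
    (hz₂ : 0 ≤ z₂) (hB : z₂ ≤ B) (hd : 0 ≤ d) (h : z₂ - z₁ ≤ d) :
    α * Real.log (γ * (z₂ + Real.exp 2)) ^ 3 ≤ α * Real.log (γ * (z₁ + Real.exp 2)) ^ 3 +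
      3 * α * Real.log (γ * (B + Real.exp 2)) ^ 2 * d := by
  have he : 1 ≤ Real.exp 2 := Real.one_le_exp (by norm_num)
  have hγ0 : 0 < γ := by linarith
  have one_le : ∀ z, 0 ≤ z → 1 ≤ γ * (z + Real.exp 2) := fun z hz => by nlinarith
  have ha : 0 ≤ Real.log (γ * (z₁ + Real.exp 2)) := Real.log_nonneg (one_le _ hz₁)
  have hb : 0 ≤ Real.log (γ * (z₂ + Real.exp 2)) := Real.log_nonneg (one_le _ hz₂)
  have hbB : Real.log (γ * (z₂ + Real.exp 2)) ≤ Real.log (γ * (B + Real.exp 2)) :=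
    Real.log_le_log (by linarith [one_le _ hz₂]) (by gcongr)
  have hdiff : Real.log (γ * (z₂ + Real.exp 2)) - Real.log (γ * (z₁ + Real.exp 2)) ≤ d := by
    have h1 : 0 < z₁ + Real.exp 2 := by linarith
    have h2 : 0 < z₂ + Real.exp 2 := by linarith
    rw [← Real.log_div (by positivity) (by positivity), mul_div_mul_left _ _ hγ0.ne']
    calc Real.log ((z₂ + Real.exp 2) / (z₁ + Real.exp 2))
        ≤ (z₂ + Real.exp 2) / (z₁ + Real.exp 2) - 1 := Real.log_le_sub_one_of_pos (by positivity)
      _ ≤ d := by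
        rw [sub_le_iff_le_add, div_le_iff₀ h1]
        nlinarith
  generalize Real.log (γ * (z₂ + Real.exp 2)) = b at *
  generalize Real.log (γ * (z₁ + Real.exp 2)) = a at *
  generalize Real.log (γ * (B + Real.exp 2)) = c at *
  have key : b ^ 3 - a ^ 3 ≤ 3 * c ^ 2 * d := by
    rcases le_total b a with hba | hab
    · have := pow_le_pow_left₀ hb hba 3
      have : 0 ≤ 3 * c ^ 2 * d := by positivity
      linarith
    · have h1 : a ^ 2 + a * b + b ^ 2 ≤ 3 * c ^ 2 := by nlinarith
      calc b ^ 3 - a ^ 3 = (a ^ 2 + a * b + b ^ 2) * (b - a) := by ring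
        _ ≤ 3 * c ^ 2 * d := by gcongr
  nlinarith

theorem measurable_intervalIntegral_left {f : ℝ → ℝ → ℝ} (hf : Measurable (Function.uncurry f))
    (T : ℝ) : Measurable fun s => ∫ u in s..T, f s u := by
  have h1 : Measurable fun s => ∫ u, (Ioc s T).indicator (f s) u := by
    have hS : MeasurableSet {p : ℝ × ℝ | p.1 < p.2 ∧ p.2 ≤ T} :=
      (measurableSet_lt measurable_fst measurable_snd).inter
        (measurableSet_le measurable_snd measurable_const)
    exact (hf.indicator hS).stronglyMeasurable.integral_prod_right'.measurable
  have h2 : Measurable fun s => ∫ u, (Ioc T s).indicator (f s) u := by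
    have hS : MeasurableSet {p : ℝ × ℝ | T < p.2 ∧ p.2 ≤ p.1} :=
      (measurableSet_lt measurable_const measurable_snd).inter
        (measurableSet_le measurable_snd measurable_fst)
    exact (hf.indicator hS).stronglyMeasurable.integral_prod_right'.measurable
  simp only [MeasureTheory.integral_indicator measurableSet_Ioc] at h1 h2
  exact h1.sub h2

theorem intervalIntegrable_of_measurable_of_bounded {f : ℝ → ℝ} (hf : Measurable f) {a b C : ℝ}
    (hab : a ≤ b) (h : ∀ s, a < s → s ≤ b → 0 ≤ f s ∧ f s ≤ C) :
    IntervalIntegrable f volume a b := by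
  rw [intervalIntegrable_iff_integrableOn_Ioc_of_le hab]
  refine Measure.integrableOn_of_bounded (M := C) (by simp) hf.aestronglyMeasurable ?_
  filter_upwards [ae_restrict_mem measurableSet_Ioc] with s hs
  obtain ⟨h0, hC⟩ := h s hs.1 hs.2
  rwa [Real.norm_of_nonneg h0]

/-- For `f` measurable with `0 ≤ f ≤ C` on the triangle, the inner integral lies in `[0, C * Y]`. -/
theorem intervalIntegral_mem_Icc_of_bounded {f : ℝ → ℝ} (hf : Measurable f) {s T C Y : ℝ}
    (hs : 0 ≤ s) (hsT : s ≤ T) (hTY : T ≤ Y) (hC : 0 ≤ C)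
    (h : ∀ u, s < u → u ≤ T → 0 ≤ f u ∧ f u ≤ C) :
    0 ≤ ∫ u in s..T, f u ∧ ∫ u in s..T, f u ≤ C * Y := by
  constructor
  · rw [integral_of_le hsT]
    exact setIntegral_nonneg measurableSet_Ioc fun u hu => (h u hu.1 hu.2).1
  · calc ∫ u in s..T, f u ≤ ∫ _ in s..T, C :=
          integral_mono_on_of_le_Ioo hsT (intervalIntegrable_of_measurable_of_bounded hf hsT h)
            intervalIntegrable_const fun u hu => (h u hu.1 hu.2.le).2
      _ = (T - s) * C := by simp
      _ ≤ C * Y := by nlinarith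

theorem intervalIntegrable_mul_log_pow_three {α γ C t T Y : ℝ} (hα : 0 < α) (hγ : 1 ≤ γ)
    (hC : 0 ≤ C) {f : ℝ → ℝ → ℝ} (hf : Measurable (Function.uncurry f))
    (ht : 0 ≤ t) (htT : t ≤ T) (hTY : T ≤ Y)
    (h : ∀ s u, 0 ≤ s → s ≤ u → s ≤ t → u ≤ T → 0 ≤ f s u ∧ f s u ≤ C) :
    IntervalIntegrable (fun s => α * Real.log (γ * ((∫ u in s..T, f s u) + Real.exp 2)) ^ 3)
      volume 0 t := by
  have hm := measurable_intervalIntegral_left hf T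
  refine intervalIntegrable_of_measurable_of_bounded
    (C := α * Real.log (γ * (C * Y + Real.exp 2)) ^ 3) (by fun_prop) ht ?_
  intro s hs hst
  obtain ⟨h0, h1⟩ := intervalIntegral_mem_Icc_of_bounded (f := f s) (by fun_prop) hs.le
    (hst.trans htT) hTY hC fun u hu huT => h s u hs.le hu.le hst huT
  have he : 1 ≤ Real.exp 2 := Real.one_le_exp (by norm_num)
  have h2 : 1 ≤ γ * ((∫ u in s..T, f s u) + Real.exp 2) := by nlinarith
  have h3 := Real.log_nonneg h2
  refine ⟨by positivity, ?_⟩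
  gcongr

/-- One step of the Picard-type iteration: a bound `b` on `f₂ - f₁` improves to its integral. -/
theorem sub_le_integral_of_sub_le {α γ C x Y : ℝ} (hα : 0 < α) (hγ : 1 ≤ γ) (hC : 0 ≤ C)
    (hY : 0 ≤ Y) {g₁ g₂ f₁ f₂ : ℝ → ℝ → ℝ}
    (hg : ∀ t T, 0 ≤ t → t ≤ T → t ≤ x → T ≤ Y → 0 ≤ g₂ t T ∧ g₂ t T ≤ g₁ t T)
    (hf₁_meas : Measurable (Function.uncurry f₁)) (hf₂_meas : Measurable (Function.uncurry f₂))
    (hf₁ : ∀ t T, 0 ≤ t → t ≤ T → t ≤ x → T ≤ Y → 0 ≤ f₁ t T ∧ f₁ t T ≤ C)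
    (hf₂ : ∀ t T, 0 ≤ t → t ≤ T → t ≤ x → T ≤ Y → 0 ≤ f₂ t T ∧ f₂ t T ≤ C)
    (hsuper : ∀ t T, 0 ≤ t → t ≤ T → t ≤ x → T ≤ Y →
      Real.exp (∫ s in (0 : ℝ)..t,
        α * Real.log (γ * ((∫ u in s..T, f₁ s u) + Real.exp 2)) ^ 3) * g₁ t T ≤ f₁ t T)
    (hsol : ∀ t T, 0 ≤ t → t ≤ T → t ≤ x → T ≤ Y →
      f₂ t T = Real.exp (∫ s in (0 : ℝ)..t,
        α * Real.log (γ * ((∫ u in s..T, f₂ s u) + Real.exp 2)) ^ 3) * g₂ t T)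
    {b : ℝ → ℝ} (hb : Continuous b) (hb0 : ∀ s, 0 ≤ s → 0 ≤ b s)
    (hsub : ∀ t T, 0 ≤ t → t ≤ T → t ≤ x → T ≤ Y → f₂ t T - f₁ t T ≤ b t)
    {t T : ℝ} (ht : 0 ≤ t) (htT : t ≤ T) (htx : t ≤ x) (hTY : T ≤ Y) :
    f₂ t T - f₁ t T ≤
      C * (3 * α * Real.log (γ * (C * Y + Real.exp 2)) ^ 2 * Y) * ∫ s in (0 : ℝ)..t, b s := by
  set L := 3 * α * Real.log (γ * (C * Y + Real.exp 2)) ^ 2 with hL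
  have hL0 : 0 ≤ L := by positivity
  have h₁ : ∀ s u, 0 ≤ s → s ≤ u → s ≤ t → u ≤ T → 0 ≤ f₁ s u ∧ f₁ s u ≤ C :=
    fun s u hs hsu hst huT => hf₁ s u hs hsu (hst.trans htx) (huT.trans hTY)
  have h₂ : ∀ s u, 0 ≤ s → s ≤ u → s ≤ t → u ≤ T → 0 ≤ f₂ s u ∧ f₂ s u ≤ C :=
    fun s u hs hsu hst huT => hf₂ s u hs hsu (hst.trans htx) (huT.trans hTY)
  have i₁ := intervalIntegrable_mul_log_pow_three hα hγ hC hf₁_meas ht htT hTY h₁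
  have i₂ := intervalIntegrable_mul_log_pow_three hα hγ hC hf₂_meas ht htT hTY h₂
  have hint0 : 0 ≤ ∫ s in (0 : ℝ)..t, b s := integral_nonneg ht fun s hs => hb0 s hs.1
  have ib : IntervalIntegrable (fun s => L * (Y * b s)) volume 0 t :=
    Continuous.intervalIntegrable (by fun_prop) _ _
  have hI : (∫ s in (0 : ℝ)..t, α * Real.log (γ * ((∫ u in s..T, f₂ s u) + Real.exp 2)) ^ 3) ≤
      (∫ s in (0 : ℝ)..t, α * Real.log (γ * ((∫ u in s..T, f₁ s u) + Real.exp 2)) ^ 3) +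
        L * Y * ∫ s in (0 : ℝ)..t, b s := by
    rw [mul_assoc, ← intervalIntegral.integral_const_mul, ← intervalIntegral.integral_const_mul,
      ← intervalIntegral.integral_add i₁ ib]
    refine integral_mono_on ht i₂ (i₁.add ib) ?_
    rintro s ⟨hs, hst⟩
    have hsT := hst.trans htT
    have b₁ := fun u (hu : s < u) (huT : u ≤ T) => h₁ s u hs hu.le hst huT
    have b₂ := fun u (hu : s < u) (huT : u ≤ T) => h₂ s u hs hu.le hst huT
    have m₁ : Measurable (f₁ s) := by fun_prop
    have m₂ : Measurable (f₂ s) := by fun_prop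
    have F₁ := intervalIntegral_mem_Icc_of_bounded m₁ hs hsT hTY hC b₁
    have F₂ := intervalIntegral_mem_Icc_of_bounded m₂ hs hsT hTY hC b₂
    have j₁ := intervalIntegrable_of_measurable_of_bounded m₁ hsT b₁
    have j₂ := intervalIntegrable_of_measurable_of_bounded m₂ hsT b₂
    have hbs := hb0 s hs
    refine mul_log_pow_three_le_add hα hγ F₁.1 F₂.1 F₂.2 (by positivity) ?_
    calc (∫ u in s..T, f₂ s u) - ∫ u in s..T, f₁ s u
        = ∫ u in s..T, (f₂ s u - f₁ s u) := (intervalIntegral.integral_sub j₂ j₁).symm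
      _ ≤ ∫ _ in s..T, b s := integral_mono_on hsT (j₂.sub j₁) intervalIntegrable_const
          fun u hu => hsub s u hs hu.1 (hst.trans htx) (hu.2.trans hTY)
      _ = (T - s) * b s := by simp
      _ ≤ Y * b s := by gcongr; linarith
  have e₁ := hsuper t T ht htT htx hTY
  have e₂ := hsol t T ht htT htx hTY
  have g := hg t T ht htT htx hTY
  have c₂ := hf₂ t T ht htT htx hTY
  generalize (∫ s in (0 : ℝ)..t,
    α * Real.log (γ * ((∫ u in s..T, f₂ s u) + Real.exp 2)) ^ 3) = I₂ at *
  generalize (∫ s in (0 : ℝ)..t,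
    α * Real.log (γ * ((∫ u in s..T, f₁ s u) + Real.exp 2)) ^ 3) = I₁ at *
  set J := L * Y * ∫ s in (0 : ℝ)..t, b s with hJ
  have hJ0 : 0 ≤ J := by positivity
  have hexp : Real.exp I₂ * (1 - J) ≤ Real.exp I₁ := by
    calc Real.exp I₂ * (1 - J) ≤ Real.exp I₂ * Real.exp (-J) := by
          gcongr
          linarith [Real.add_one_le_exp (-J)]
      _ = Real.exp (I₂ + -J) := (Real.exp_add _ _).symm
      _ ≤ Real.exp I₁ := Real.exp_le_exp.2 (by linarith)
  have hlow : f₂ t T * (1 - J) ≤ f₁ t T := by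
    calc f₂ t T * (1 - J) = Real.exp I₂ * (1 - J) * g₂ t T := by rw [e₂]; ring
      _ ≤ Real.exp I₁ * g₂ t T := mul_le_mul_of_nonneg_right hexp g.1
      _ ≤ Real.exp I₁ * g₁ t T := by gcongr; exact g.2
      _ ≤ f₁ t T := e₁
  calc f₂ t T - f₁ t T ≤ f₂ t T * J := by linarith
    _ ≤ C * J := mul_le_mul_of_nonneg_right c₂.2 hJ0
    _ = C * (L * Y) * ∫ s in (0 : ℝ)..t, b s := by rw [hJ]; ring

/-- comparison principle for the integral equation driven by
`R_{α,γ}(z) = α·(log(γ(z+e²)))³` on the region `𝒯_{x,y−δ}`: a bounded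
supersolution with larger data dominates the bounded solution with smaller
data. -/
theorem stmt11 (Tstar : ℝ) (hTstar : 0 < Tstar)
    (α γ x y δ : ℝ) (hα : 0 < α) (hγ : 1 ≤ γ) (hαγ : 2 < α * γ) (hγT : 1 < γ * Tstar)
    (hx : 0 < x) (hxy : x < y) (hy : y < min (α / 2) Tstar) (hgap : 1 < γ * (y - x))
    (hδ : 0 < δ) (hδy : δ < y)
    (g₁ g₂ : ℝ → ℝ → ℝ)
    (hg₁_meas : Measurable (Function.uncurry g₁)) (hg₂_meas : Measurable (Function.uncurry g₂))
    (Cg : ℝ) (hg₂_bdd : ∀ t T, 0 ≤ t → t ≤ T → T ≤ Tstar → t ≤ x → T ≤ y - δ → g₂ t T ≤ Cg)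
    (hg₁₂ : ∀ t T, 0 ≤ t → t ≤ T → T ≤ Tstar → t ≤ x → T ≤ y - δ →
      0 ≤ g₂ t T ∧ g₂ t T ≤ g₁ t T)
    (f₁ f₂ : ℝ → ℝ → ℝ)
    (hf₁_meas : Measurable (Function.uncurry f₁)) (hf₂_meas : Measurable (Function.uncurry f₂))
    (hf₁_nonneg : ∀ t T, 0 ≤ t → t ≤ T → T ≤ Tstar → t ≤ x → T ≤ y - δ → 0 ≤ f₁ t T)
    (hf₂_nonneg : ∀ t T, 0 ≤ t → t ≤ T → T ≤ Tstar → t ≤ x → T ≤ y - δ → 0 ≤ f₂ t T)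
    (C₁ : ℝ) (hf₁_bdd : ∀ t T, 0 ≤ t → t ≤ T → T ≤ Tstar → t ≤ x → T ≤ y - δ → f₁ t T ≤ C₁)
    (C₂ : ℝ) (hf₂_bdd : ∀ t T, 0 ≤ t → t ≤ T → T ≤ Tstar → t ≤ x → T ≤ y - δ → f₂ t T ≤ C₂)
    (hineq₁ : ∀ t T, 0 ≤ t → t ≤ T → T ≤ Tstar → t ≤ x → T ≤ y - δ →
      Real.exp (∫ s in (0 : ℝ)..t,
        α * Real.log (γ * ((∫ u in s..T, f₁ s u) + Real.exp 2)) ^ 3) * g₁ t T ≤ f₁ t T)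
    (heq₂ : ∀ t T, 0 ≤ t → t ≤ T → T ≤ Tstar → t ≤ x → T ≤ y - δ →
      f₂ t T = Real.exp (∫ s in (0 : ℝ)..t,
        α * Real.log (γ * ((∫ u in s..T, f₂ s u) + Real.exp 2)) ^ 3) * g₂ t T) :
    ∀ t T, 0 ≤ t → t ≤ T → T ≤ Tstar → t ≤ x → T ≤ y - δ → f₂ t T ≤ f₁ t T := by
  set Y := y - δ with hY
  have hY0 : 0 ≤ Y := by linarith
  have hTs : ∀ T, T ≤ Y → T ≤ Tstar := fun T hT => by
    have := min_le_right (α / 2) Tstar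
    linarith
  set C := max (max C₁ C₂) 0 with hC
  have hC0 : 0 ≤ C := le_max_right _ _
  have hC₁ : C₁ ≤ C := (le_max_left _ _).trans (le_max_left _ _)
  have hC₂ : C₂ ≤ C := (le_max_right _ _).trans (le_max_left _ _)
  have hf₁ : ∀ t T, 0 ≤ t → t ≤ T → t ≤ x → T ≤ Y → 0 ≤ f₁ t T ∧ f₁ t T ≤ C :=
    fun t T h0 h1 h2 h3 => ⟨hf₁_nonneg t T h0 h1 (hTs T h3) h2 h3,
      (hf₁_bdd t T h0 h1 (hTs T h3) h2 h3).trans hC₁⟩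
  have hf₂ : ∀ t T, 0 ≤ t → t ≤ T → t ≤ x → T ≤ Y → 0 ≤ f₂ t T ∧ f₂ t T ≤ C :=
    fun t T h0 h1 h2 h3 => ⟨hf₂_nonneg t T h0 h1 (hTs T h3) h2 h3,
      (hf₂_bdd t T h0 h1 (hTs T h3) h2 h3).trans hC₂⟩
  set A := C * (3 * α * Real.log (γ * (C * Y + Real.exp 2)) ^ 2 * Y) with hA
  have hA0 : 0 ≤ A := by positivity
  have iter : ∀ n : ℕ, ∀ t T, 0 ≤ t → t ≤ T → t ≤ x → T ≤ Y →
      f₂ t T - f₁ t T ≤ C * ((A * t) ^ n / n.factorial) := by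
    intro n
    induction n with
    | zero =>
      intro t T h0 h1 h2 h3
      have := (hf₁ t T h0 h1 h2 h3).1
      have := (hf₂ t T h0 h1 h2 h3).2
      simp
      linarith
    | succ n ih =>
      intro t T h0 h1 h2 h3
      have step := sub_le_integral_of_sub_le hα hγ hC0 hY0
        (fun t T h0 h1 h2 h3 => hg₁₂ t T h0 h1 (hTs T h3) h2 h3) hf₁_meas hf₂_meas hf₁ hf₂
        (fun t T h0 h1 h2 h3 => hineq₁ t T h0 h1 (hTs T h3) h2 h3)
        (fun t T h0 h1 h2 h3 => heq₂ t T h0 h1 (hTs T h3) h2 h3)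
        (b := fun s => C * ((A * s) ^ n / n.factorial)) (by fun_prop)
        (fun s hs => by positivity) ih h0 h1 h2 h3
      refine step.trans_eq ?_
      rw [← hA]
      simp only [mul_pow, intervalIntegral.integral_const_mul, intervalIntegral.integral_div,
        integral_pow, Nat.factorial_succ]
      push_cast
      field_simp
      ring
  intro t T h0 h1 _ h2 h3
  have hlim : Filter.Tendsto (fun n : ℕ => C * ((A * t) ^ n / n.factorial)) Filter.atTop
      (nhds (C * 0)) := (FloorSemiring.tendsto_pow_div_factorial_atTop (A * t)).const_mul C
  have := ge_of_tendsto' hlim fun n => iter n t T h0 h1 h2 h3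
  linarith
end

section
/- Fix T* > 0 and set 𝒯 := {(t,T) ∈ ℝ² : 0 ≤ t ≤ T ≤ T*}. Let λ̲, λ̄ with 0 < λ̲ ≤ λ̄ < ∞, and let a > 0 and b ∈ ℝ. Let J′ : [0, ∞) → ℝ be monotone increasing with J′(z) ≥ a·(log z)³ + b for all z > 0. Then there exists a constant K > 0 such that: for every measurable λ : 𝒯 → ℝ with λ̲ ≤ λ(t,T) ≤ λ̄ on 𝒯 and every measurable ā : 𝒯 → ℝ with ā(t,T) ≥ K for all (t,T) ∈ 𝒯, there is NO bounded measurable function f : 𝒯 → [0, ∞) satisfying f(t,T) = ā(t,T)·exp(∫₀ᵗ J′(∫ₛᵀ λ(s,u) f(s,u) du) λ(s,T) ds) for all (t,T) ∈ 𝒯. -/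
open MeasureTheory Set intervalIntegral

/-- A measurable function with bounds on `(p, q]` is interval integrable on `[p, q]`. -/
theorem intervalIntegrable_of_forall_bounds {g : ℝ → ℝ} {p q lo hi : ℝ} (hpq : p ≤ q)
    (hg : AEStronglyMeasurable g (volume.restrict (Ioc p q)))
    (hb : ∀ x ∈ Ioc p q, lo ≤ g x ∧ g x ≤ hi) :
    IntervalIntegrable g volume p q := by
  rw [intervalIntegrable_iff_integrableOn_Ioc_of_le hpq]
  refine Integrable.of_bound hg (max |lo| |hi|) ?_
  filter_upwards [ae_restrict_mem measurableSet_Ioc] with x hx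
  exact abs_le_max_abs_abs (hb x hx).1 (hb x hx).2

theorem measurable_setIntegral_Ioc_left {g : ℝ → ℝ → ℝ} (hg : Measurable (Function.uncurry g))
    (T : ℝ) : Measurable fun s => ∫ u in Ioc s T, g s u := by
  have hset : MeasurableSet {p : ℝ × ℝ | p.2 ∈ Ioc p.1 T} :=
    (measurableSet_lt measurable_fst measurable_snd).inter
      (measurableSet_le measurable_snd measurable_const)
  have h := ((hg.indicator hset).stronglyMeasurable.integral_prod_right' (ν := volume)).measurable
  convert h using 2 with s
  rw [← MeasureTheory.integral_indicator measurableSet_Ioc]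
  rfl

/-- The drift integrand `s ↦ J′(∫ₛᵀ g(s,u) du) l(s)` is integrable, for `J` monotone and bounded
nonnegative `g` and `l`. -/
theorem intervalIntegrable_comp_integral_mul {J : ℝ → ℝ} (hJ : MonotoneOn J (Ici 0))
    {g : ℝ → ℝ → ℝ} (hg : Measurable (Function.uncurry g)) {l : ℝ → ℝ} (hl : Measurable l)
    {t T G M : ℝ} (ht : 0 ≤ t) (htT : t ≤ T)
    (hgb : ∀ s u, 0 ≤ s → s ≤ u → u ≤ T → 0 ≤ g s u ∧ g s u ≤ G)
    (hlb : ∀ s, 0 ≤ s → s ≤ t → 0 ≤ l s ∧ l s ≤ M) :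
    IntervalIntegrable (fun s => J (∫ u in s..T, g s u) * l s) volume 0 t := by
  have hG : 0 ≤ G := (hgb 0 0 le_rfl le_rfl (ht.trans htT)).1.trans
    (hgb 0 0 le_rfl le_rfl (ht.trans htT)).2
  have hI : ∀ s ∈ Ioc 0 t, 0 ≤ ∫ u in s..T, g s u ∧ ∫ u in s..T, g s u ≤ G * T := by
    intro s hs
    have hsT : s ≤ T := hs.2.trans htT
    have hint : IntervalIntegrable (g s) volume s T :=
      intervalIntegrable_of_forall_bounds hsT
        (hg.comp measurable_prodMk_left).aestronglyMeasurable
        fun u hu => hgb s u hs.1.le hu.1.le hu.2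
    refine ⟨integral_nonneg hsT fun u hu => (hgb s u hs.1.le hu.1 hu.2).1, ?_⟩
    calc ∫ u in s..T, g s u ≤ ∫ _ in s..T, G :=
          integral_mono_on hsT hint (by simp) fun u hu => (hgb s u hs.1.le hu.1 hu.2).2
      _ = (T - s) * G := by simp
      _ ≤ G * T := by nlinarith [hs.1]
  have hJm : Measurable fun z => J (max z 0) :=
    Monotone.measurable fun x y hxy =>
      hJ (mem_Ici.2 (le_max_right x 0)) (mem_Ici.2 (le_max_right y 0)) (max_le_max_right 0 hxy)
  have hmeas : AEStronglyMeasurable (fun s => J (∫ u in s..T, g s u) * l s)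
      (volume.restrict (Ioc 0 t)) := by
    refine ((hJm.comp (measurable_setIntegral_Ioc_left hg T)).mul
      hl).aestronglyMeasurable.congr ?_
    filter_upwards [ae_restrict_mem measurableSet_Ioc] with s hs
    have h0 := (hI s hs).1
    rw [integral_of_le (hs.2.trans htT)] at h0 ⊢
    simp [max_eq_left h0]
  refine intervalIntegrable_of_forall_bounds (lo := -(max |J 0| |J (G * T)| * M))
    (hi := max |J 0| |J (G * T)| * M) ht hmeas fun s hs => ?_
  rw [← abs_le, abs_mul, abs_of_nonneg (hlb s hs.1.le hs.2).1]
  have h := hI s hs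
  have hGT : 0 ≤ G * T := h.1.trans h.2
  exact mul_le_mul (abs_le_max_abs_abs (hJ self_mem_Ici h.1 h.1) (hJ h.1 hGT h.2))
    (hlb s hs.1.le hs.2).2 (hlb s hs.1.le hs.2).1 (by positivity)

/-- A function bounded below by `-m` everywhere and by `q - m` from `r` on has integral at least
`(t - r) q - t m`. -/
theorem le_integral_of_le_of_le {g : ℝ → ℝ} {r t q m : ℝ} (hr : 0 ≤ r) (hrt : r ≤ t)
    (hg : IntervalIntegrable g volume 0 t) (hm : ∀ s ∈ Icc 0 t, -m ≤ g s)
    (hq : ∀ s ∈ Icc r t, q - m ≤ g s) :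
    (t - r) * q - t * m ≤ ∫ s in (0 : ℝ)..t, g s := by
  have h1 : IntervalIntegrable g volume 0 r :=
    hg.mono_set (by rw [uIcc_of_le hr, uIcc_of_le (hr.trans hrt)]; exact Icc_subset_Icc_right hrt)
  have h2 : IntervalIntegrable g volume r t :=
    hg.mono_set (by rw [uIcc_of_le hrt, uIcc_of_le (hr.trans hrt)]; exact Icc_subset_Icc_left hr)
  have e1 : ∫ _ in (0 : ℝ)..r, -m ≤ ∫ s in (0 : ℝ)..r, g s :=
    integral_mono_on hr (by simp) h1 fun s hs => hm s ⟨hs.1, hs.2.trans hrt⟩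
  have e2 : ∫ _ in r..t, (q - m) ≤ ∫ s in r..t, g s :=
    integral_mono_on hrt (by simp) h2 hq
  rw [← integral_add_adjacent_intervals h1 h2]
  simp only [intervalIntegral.integral_const, smul_eq_mul] at e1 e2
  linarith

/-- If `g ≥ m` on `[r, T]` and `g ≥ 0` on `[s, T]`, then `∫ₛᵀ g ≥ d m` whenever
`r ∈ [s, T]` and `T - r ≥ d`. -/
theorem mul_le_integral_of_le_on_right {g : ℝ → ℝ} {s r T m d : ℝ} (hsr : s ≤ r) (hrT : r ≤ T)
    (hd : d ≤ T - r) (hm0 : 0 ≤ m) (hg : IntervalIntegrable g volume s T)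
    (h0 : ∀ u ∈ Icc s T, 0 ≤ g u) (hm : ∀ u ∈ Icc r T, m ≤ g u) :
    d * m ≤ ∫ u in s..T, g u := by
  have h1 : IntervalIntegrable g volume s r :=
    hg.mono_set (by rw [uIcc_of_le hsr, uIcc_of_le (hsr.trans hrT)]; exact Icc_subset_Icc_right hrT)
  have h2 : IntervalIntegrable g volume r T :=
    hg.mono_set (by rw [uIcc_of_le hrT, uIcc_of_le (hsr.trans hrT)]; exact Icc_subset_Icc_left hsr)
  have e1 : 0 ≤ ∫ u in s..r, g u := integral_nonneg hsr fun u hu => h0 u ⟨hu.1, hu.2.trans hrT⟩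
  have e2 : ∫ _ in r..T, m ≤ ∫ u in r..T, g u := integral_mono_on hrT (by simp) h2 hm
  rw [← integral_add_adjacent_intervals h1 h2]
  simp only [intervalIntegral.integral_const, smul_eq_mul] at e2
  nlinarith

/-- Choice of the logarithmic size of the initial data that makes the doubling iteration run. -/
theorem exists_doubling_rate {k c : ℝ} (hk : 0 < k) (hc : 0 < c) :
    ∃ L > (0 : ℝ), ∀ n : ℕ,
      L * 2 ^ n / 2 ≤ Real.log (c / 2 ^ n) + L * 2 ^ n ∧
      L * 2 ^ (n + 1) ≤ k / 2 ^ n * (L * 2 ^ n / 2) ^ 3 := by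
  refine ⟨2 * (|Real.log c| + 1) + 16 / k, by positivity, fun n => ?_⟩
  set L := 2 * (|Real.log c| + 1) + 16 / k with hL
  have hp : (1 : ℝ) ≤ 2 ^ n := one_le_pow₀ (by norm_num)
  have hn : (n : ℝ) ≤ 2 ^ n := by exact_mod_cast Nat.lt_two_pow_self.le
  have h16 : 0 < 16 / k := by positivity
  have hl := abs_nonneg (Real.log c)
  constructor
  · rw [Real.log_div hc.ne' (by positivity), Real.log_pow]
    have h2 : Real.log 2 ≤ 1 := by linarith [Real.log_two_lt_d9]
    have h3 : (n : ℝ) * Real.log 2 ≤ 2 ^ n :=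
      (mul_le_of_le_one_right n.cast_nonneg h2).trans hn
    have h4 : |Real.log c| ≤ |Real.log c| * 2 ^ n := le_mul_of_one_le_right hl hp
    have h5 : (2 * (|Real.log c| + 1)) * 2 ^ n ≤ L * 2 ^ n := by
      gcongr
      linarith
    linarith [neg_abs_le (Real.log c)]
  · have hL1 : 1 ≤ L := by linarith
    have hkL : 16 ≤ k * L := by
      have : k * (16 / k) ≤ k * L := by gcongr; linarith
      rwa [mul_div_cancel₀ _ hk.ne'] at this
    have h6 : 16 ≤ k * L * L * 2 ^ n := by
      calc (16 : ℝ) = 16 * 1 * 1 := by norm_num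
        _ ≤ k * L * L * 2 ^ n := by gcongr
    have e : k / 2 ^ n * (L * 2 ^ n / 2) ^ 3 = (k * L * L * 2 ^ n) * (L * 2 ^ n) / 8 := by
      field_simp
      ring
    rw [e, pow_succ]
    have : 0 < L * 2 ^ n := by positivity
    nlinarith

/-- the deterministic core of the non-existence theorem: if `J′`
is monotone increasing and grows at least like `a·(log z)³ + b`, then there is
a threshold `K > 0` such that for any admissible volatility coefficient `λ` and
any data `ā ≥ K` on the triangle `𝒯`, the HJM fixed-point equation has no
bounded nonnegative measurable solution. -/
theorem stmt15 (Tstar : ℝ) (hTstar : 0 < Tstar)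
    (lamL lamU : ℝ) (hlamL : 0 < lamL) (hlamLU : lamL ≤ lamU)
    (a b : ℝ) (ha : 0 < a)
    (J' : ℝ → ℝ) (hJmono : MonotoneOn J' (Ici 0))
    (hJgrow : ∀ z > (0 : ℝ), a * Real.log z ^ 3 + b ≤ J' z) :
    ∃ K > (0 : ℝ),
      ∀ lam : ℝ → ℝ → ℝ, Measurable (Function.uncurry lam) →
        (∀ t T, 0 ≤ t → t ≤ T → T ≤ Tstar → lamL ≤ lam t T ∧ lam t T ≤ lamU) →
      ∀ abar : ℝ → ℝ → ℝ, Measurable (Function.uncurry abar) →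
        (∀ t T, 0 ≤ t → t ≤ T → T ≤ Tstar → K ≤ abar t T) →
      ¬ ∃ f : ℝ → ℝ → ℝ, Measurable (Function.uncurry f) ∧
          (∃ C : ℝ, ∀ t T, 0 ≤ t → t ≤ T → T ≤ Tstar → 0 ≤ f t T ∧ f t T ≤ C) ∧
          ∀ t T, 0 ≤ t → t ≤ T → T ≤ Tstar →
            f t T = abar t T * Real.exp (∫ s in (0 : ℝ)..t,
              J' (∫ u in s..T, lam s u * f s u) * lam s T) := by
  set c : ℝ := Tstar / 4 with hc
  have hc0 : 0 < c := by positivity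
  have hlamU : 0 < lamU := hlamL.trans_le hlamLU
  obtain ⟨L, hL, hrate⟩ := exists_doubling_rate (k := c * (lamL * a)) (c := lamL * c)
    (by positivity) (by positivity)
  set B : ℝ := |J' 0| + |b| with hB
  have hB0 : 0 ≤ B := by positivity
  have hJB : ∀ z, 0 ≤ z → 0 ≤ J' z + B := fun z hz => by
    have := hJmono self_mem_Ici (mem_Ici.2 hz) hz
    linarith [neg_abs_le (J' 0), abs_nonneg b]
  refine ⟨Real.exp (L + Tstar * (B * lamU)), Real.exp_pos _, ?_⟩
  rintro lam hlam hlamb abar - habar ⟨f, hf, ⟨C, hC⟩, heq⟩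
  have hlamf : Measurable (Function.uncurry fun s u => lam s u * f s u) := hlam.mul hf
  have hlamfb : ∀ s u, 0 ≤ s → s ≤ u → u ≤ Tstar →
      0 ≤ lam s u * f s u ∧ lam s u * f s u ≤ lamU * C := fun s u hs hsu hu => by
    have h1 := hlamb s u hs hsu hu
    have h2 := hC s u hs hsu hu
    exact ⟨mul_nonneg (hlamL.le.trans h1.1) h2.1, mul_le_mul h1.2 h2.2 h2.1 hlamU.le⟩
  have hI0 : ∀ s T, 0 ≤ s → s ≤ T → T ≤ Tstar → 0 ≤ ∫ u in s..T, lam s u * f s u :=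
    fun s T hs hsT hT => integral_nonneg hsT fun u hu =>
      (hlamfb s u hs hu.1 (hu.2.trans hT)).1
  have hlow : ∀ r t T q, 0 ≤ r → r ≤ t → t ≤ T → T ≤ Tstar → 0 ≤ q →
      (∀ s ∈ Icc r t, q ≤ J' (∫ u in s..T, lam s u * f s u) + B) →
      Real.exp (L + (t - r) * (lamL * q)) ≤ f t T := by
    intro r t T q hr hrt htT hT hq hJq
    have ht : 0 ≤ t := hr.trans hrt
    have hint := intervalIntegrable_comp_integral_mul hJmono hlamf
      (l := fun s => lam s T) (hlam.comp measurable_prodMk_right) ht htT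
      (fun s u hs hsu hu => hlamfb s u hs hsu (hu.trans hT))
      (fun s hs hst => ⟨hlamL.le.trans (hlamb s T hs (hst.trans htT) hT).1,
        (hlamb s T hs (hst.trans htT) hT).2⟩)
    have key := le_integral_of_le_of_le (q := lamL * q) (m := B * lamU) hr hrt hint
      (fun s hs => by
        have h1 := hlamb s T hs.1 (hs.2.trans htT) hT
        have h2 := hJB _ (hI0 s T hs.1 (hs.2.trans htT) hT)
        have h3 := mul_nonneg h2 (hlamL.le.trans h1.1)
        have h4 := mul_le_mul_of_nonneg_left h1.2 hB0
        linarith)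
      (fun s hs => by
        have h1 := hlamb s T (hr.trans hs.1) (hs.2.trans htT) hT
        have h3 := mul_le_mul h1.1 (hJq s hs) hq (hlamL.le.trans h1.1)
        have h4 := mul_le_mul_of_nonneg_left h1.2 hB0
        linarith)
    rw [heq t T ht htT hT]
    have h5 : t * (B * lamU) ≤ Tstar * (B * lamU) := by
      gcongr
      exact htT.trans hT
    calc Real.exp (L + (t - r) * (lamL * q))
        ≤ Real.exp (L + Tstar * (B * lamU)) * Real.exp (∫ s in (0 : ℝ)..t,
            J' (∫ u in s..T, lam s u * f s u) * lam s T) := by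
          rw [← Real.exp_add]
          exact Real.exp_le_exp.2 (by linarith)
      _ ≤ _ := by
          gcongr
          exact habar t T ht htT hT
  have hiter : ∀ n : ℕ, ∀ t T, 2 * c * (1 - 1 / 2 ^ n) ≤ t → t ≤ 2 * c →
      2 * c + 2 * c * (1 - 1 / 2 ^ n) ≤ T → T ≤ Tstar → Real.exp (L * 2 ^ n) ≤ f t T := by
    intro n
    induction n with
    | zero =>
      intro t T ht ht' hT hT'
      norm_num at ht hT ⊢
      have := hlow t t T 0 ht le_rfl (by linarith) hT' le_rfl fun s hs =>
        hJB _ (hI0 s T (ht.trans hs.1) (by linarith [hs.2]) hT')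
      simpa using this
    | succ n ih =>
      intro t T ht ht' hT hT'
      have hhalf : 2 * c * (1 - 1 / 2 ^ (n + 1)) = 2 * c * (1 - 1 / 2 ^ n) + c / 2 ^ n := by
        rw [pow_succ]
        field_simp
        ring
      set δ := c / 2 ^ n with hδ
      set r := 2 * c * (1 - 1 / 2 ^ n) with hr
      have hδ0 : 0 < δ := by positivity
      have hr0 : 0 ≤ r := by
        have : (1 : ℝ) / 2 ^ n ≤ 1 := div_le_one_of_le₀ (one_le_pow₀ (by norm_num)) (by positivity)
        exact mul_nonneg (by linarith) (by linarith)
      rw [hhalf] at ht hT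
      have hq0 : 0 ≤ L * 2 ^ n / 2 := by positivity
      refine le_trans (Real.exp_le_exp.2 ?_) (hlow r t T (a * (L * 2 ^ n / 2) ^ 3) hr0
        (by linarith) (by linarith) hT' (by positivity) fun s hs => ?_)
      · have h1 := (hrate n).2
        have h2 : δ * (lamL * (a * (L * 2 ^ n / 2) ^ 3)) ≤
            (t - r) * (lamL * (a * (L * 2 ^ n / 2) ^ 3)) := by
          gcongr
          linarith
        have h3 : c * (lamL * a) / 2 ^ n * (L * 2 ^ n / 2) ^ 3 =
            δ * (lamL * (a * (L * 2 ^ n / 2) ^ 3)) := by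
          rw [hδ]
          ring
        linarith
      · have hs0 : 0 ≤ s := hr0.trans hs.1
        have hsT : s ≤ T := by linarith [hs.2]
        have hI : δ * (lamL * Real.exp (L * 2 ^ n)) ≤ ∫ u in s..T, lam s u * f s u := by
          refine mul_le_integral_of_le_on_right (r := 2 * c + r) (by linarith [hs.2])
            (by linarith) (by linarith) (by positivity) ?_
            (fun u hu => (hlamfb s u hs0 hu.1 (hu.2.trans hT')).1) fun u hu => ?_
          · exact intervalIntegrable_of_forall_bounds hsT
              (hlamf.comp measurable_prodMk_left).aestronglyMeasurable
              fun u hu => hlamfb s u hs0 hu.1.le (hu.2.trans hT')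
          · have h1 := hlamb s u hs0 (by linarith [hu.1, hs.2]) (hu.2.trans hT')
            exact mul_le_mul h1.1 (ih s u hs.1 (hs.2.trans ht') hu.1 (hu.2.trans hT'))
              (Real.exp_pos _).le (hlamL.le.trans h1.1)
        have hpos : 0 < δ * (lamL * Real.exp (L * 2 ^ n)) := by positivity
        have hlog : L * 2 ^ n / 2 ≤ Real.log (∫ u in s..T, lam s u * f s u) := by
          refine (hrate n).1.trans (le_trans (le_of_eq ?_) (Real.log_le_log hpos hI))
          rw [← mul_assoc, Real.log_mul (by positivity) (Real.exp_pos _).ne', Real.log_exp, hδ]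
          congr 2
          ring
        have h1 := hJgrow _ (hpos.trans_le hI)
        have h2 : a * (L * 2 ^ n / 2) ^ 3 ≤
            a * Real.log (∫ u in s..T, lam s u * f s u) ^ 3 := by
          gcongr
        linarith [neg_abs_le b, abs_nonneg (J' 0)]
  have hgrow : Filter.Tendsto (fun n : ℕ => Real.exp (L * 2 ^ n)) Filter.atTop Filter.atTop :=
    Real.tendsto_exp_atTop.comp
      ((tendsto_pow_atTop_atTop_of_one_lt (by norm_num : (1 : ℝ) < 2)).const_mul_atTop hL)
  obtain ⟨n, hn⟩ := (hgrow.eventually_gt_atTop C).exists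
  have hle : 2 * c * (1 - 1 / 2 ^ n) ≤ 2 * c :=
    mul_le_of_le_one_right (by linarith) (by linarith [show (0 : ℝ) < 1 / 2 ^ n by positivity])
  have h1 := hiter n (2 * c) Tstar hle le_rfl (by linarith) le_rfl
  linarith [(hC (2 * c) Tstar (by linarith) (by linarith) le_rfl).2]
end
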